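/- Let A = (a_i)_{i≥1} be a strictly increasing sequence of positive integers such that gcd(a_i, a_j) = 1 for all 1 ≤ i < j ≤ 4, and let k > 4 be an integer. Then for every integer n > 2·k²·(k−1)!·(a_1a_2a_3)³·a_k^{k+3}·e^{1/a_k}, one has p_A(n,k)² > (1 + 1/n²)·p_A(n+1,k)·p_A(n−1,k); in particular p_A(n,k)² > p_A(n+1,k)·p_A(n−1,k) for all such n. -/

import Mathlib

/-- The restricted partition function `p_A(n,k)` for the sequence `a` (0-indexed, so the
paper's `a_i` is `a (i-1)`): the number of `k`-tuples `(c_0,…,c_{k-1})` of nonnegative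
integers with `c_0·a_0 + ⋯ + c_{k-1}·a_{k-1} = n`.
It equals `0` for `n < 0` and `1` for `n = 0`. -/
noncomputable def pA (a : ℕ → ℕ) (k : ℕ) (n : ℤ) : ℕ :=
  Set.ncard {c : Fin k → ℕ | (∑ i, (c i : ℤ) * (a i.val : ℤ)) = n}

lemma pA_set_finite {a : ℕ → ℕ} (hpos : ∀ i, 0 < a i) (k : ℕ) (n : ℤ) :
    {c : Fin k → ℕ | (∑ i, (c i : ℤ) * (a i.val : ℤ)) = n}.Finite := by
  refine (Set.finite_Iic (fun _ : Fin k => n.toNat)).subset fun c hc i => ?_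
  have h1 : (c i : ℤ) * (a i.val : ℤ) ≤ n := by
    rw [← show (∑ i, (c i : ℤ) * (a i.val : ℤ)) = n from hc]
    exact Finset.single_le_sum (f := fun i : Fin k => (c i : ℤ) * (a i.val : ℤ))
      (fun j _ => by positivity) (Finset.mem_univ i)
  have h2 : (1 : ℤ) ≤ a i.val := by exact_mod_cast hpos i
  have h3 : (c i : ℤ) ≤ n := by nlinarith [Int.natCast_nonneg (c i)]
  show c i ≤ n.toNat
  omega

lemma pA_of_neg (a : ℕ → ℕ) (k : ℕ) {n : ℤ} (hn : n < 0) : pA a k n = 0 := by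
  have : {c : Fin k → ℕ | (∑ i, (c i : ℤ) * (a i.val : ℤ)) = n} = ∅ := by
    ext c
    simp only [Set.mem_ofPred_eq, Set.mem_empty_iff_false, iff_false]
    have : (0 : ℤ) ≤ ∑ i, (c i : ℤ) * (a i.val : ℤ) := Finset.sum_nonneg fun j _ => by positivity
    omega
  rw [pA, this, Set.ncard_empty]

lemma pA_zero (a : ℕ → ℕ) (n : ℤ) : pA a 0 n = if n = 0 then 1 else 0 := by
  unfold pA
  split_ifs with h
  · subst h
    simp
  · simp [Ne.symm h]

lemma pA_succ {a : ℕ → ℕ} (hpos : ∀ i, 0 < a i) (k : ℕ) (n : ℤ) :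
    pA a (k + 1) n = pA a k n + pA a (k + 1) (n - a k) := by
  let f : (Fin k → ℕ) → (Fin (k + 1) → ℕ) := fun c => Fin.snoc c 0
  let g : (Fin (k + 1) → ℕ) → (Fin (k + 1) → ℕ) := fun c => c + Pi.single (Fin.last k) 1
  have hf : Function.Injective f := fun c d h => by
    funext i
    simpa [f] using congrFun h i.castSucc
  have hg : Function.Injective g := fun c d h => add_right_cancel h
  have hset : {c : Fin (k + 1) → ℕ | (∑ i, (c i : ℤ) * (a i.val : ℤ)) = n} =
      f '' {c : Fin k → ℕ | (∑ i, (c i : ℤ) * (a i.val : ℤ)) = n} ∪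
      g '' {c : Fin (k + 1) → ℕ | (∑ i, (c i : ℤ) * (a i.val : ℤ)) = n - a k} := by
    ext c
    constructor
    · intro hc
      have hc : (∑ i, (c i : ℤ) * (a i.val : ℤ)) = n := hc
      rw [Fin.sum_univ_castSucc] at hc
      rcases Nat.eq_zero_or_pos (c (Fin.last k)) with h0 | h0
      · left
        refine ⟨fun i => c i.castSucc, ?_, ?_⟩
        · simpa [h0] using hc
        · funext i
          refine Fin.lastCases ?_ (fun i => ?_) i <;> simp [f, h0]
      · right
        refine ⟨c - Pi.single (Fin.last k) 1, ?_, ?_⟩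
        · show (∑ i, _) = _
          rw [Fin.sum_univ_castSucc]
          have : ((c (Fin.last k) - 1 : ℕ) : ℤ) = (c (Fin.last k) : ℤ) - 1 := by omega
          simp only [Pi.sub_apply, Pi.single_eq_same, this]
          simp only [Pi.single_eq_of_ne (Fin.castSucc_lt_last _).ne, Fin.val_last,
            Fin.val_castSucc, Nat.sub_zero] at hc ⊢
          linarith
        · funext i
          refine Fin.lastCases ?_ (fun i => ?_) i
          · simp [g]; omega
          · simp [g]
    · rintro (⟨c, hc, rfl⟩ | ⟨c, hc, rfl⟩)
      · have hc : (∑ i, (c i : ℤ) * (a i.val : ℤ)) = n := hc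
        show (∑ i, _) = _
        rw [Fin.sum_univ_castSucc]
        simpa [f] using hc
      · have hc : (∑ i, (c i : ℤ) * (a i.val : ℤ)) = n - a k := hc
        show (∑ i, _) = _
        rw [Fin.sum_univ_castSucc] at hc ⊢
        simp only [g, Pi.add_apply, Pi.single_eq_same,
          Pi.single_eq_of_ne (Fin.castSucc_lt_last _).ne, Fin.val_last,
            Fin.val_castSucc, Nat.add_zero] at hc ⊢
        push_cast
        linarith
  have hdisj : Disjoint (f '' {c : Fin k → ℕ | (∑ i, (c i : ℤ) * (a i.val : ℤ)) = n})
      (g '' {c : Fin (k + 1) → ℕ | (∑ i, (c i : ℤ) * (a i.val : ℤ)) = n - a k}) := by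
    rw [Set.disjoint_left]
    rintro _ ⟨c, _, rfl⟩ ⟨d, _, h⟩
    simpa [f, g] using congrFun h (Fin.last k)
  unfold pA
  rw [hset, Set.ncard_union_eq hdisj ((pA_set_finite hpos k n).image f)
    ((pA_set_finite hpos (k + 1) _).image g), Set.ncard_image_of_injective _ hf,
    Set.ncard_image_of_injective _ hg]

open PowerSeries in
lemma coeff_eq_of_mul_one_sub_X_pow {F G : PowerSeries ℝ} {a : ℕ}
    (h : G * (1 - X ^ a) = F) (n : ℕ) :
    coeff n G = coeff n F + if a ≤ n then coeff (n - a) G else 0 := by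
  rw [← h, mul_sub, mul_one, map_sub, coeff_mul_X_pow']
  ring

/-- The generating function of `n ↦ pA a k n`. -/
noncomputable def pASeries (a : ℕ → ℕ) (k : ℕ) : PowerSeries ℝ :=
  PowerSeries.mk fun n => (pA a k n : ℝ)

open PowerSeries in
lemma pASeries_zero (a : ℕ → ℕ) : pASeries a 0 = 1 := by
  ext n
  simp [pASeries, pA_zero, coeff_one]

open PowerSeries in
lemma pASeries_succ {a : ℕ → ℕ} (hpos : ∀ i, 0 < a i) (k : ℕ) :
    pASeries a (k + 1) * (1 - X ^ a k) = pASeries a k := by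
  ext n
  rw [mul_sub, mul_one, map_sub, coeff_mul_X_pow']
  simp only [pASeries, coeff_mk, pA_succ hpos k n]
  split_ifs with h
  · push_cast [h]
    ring
  · rw [pA_of_neg (n := (n : ℤ) - a k) _ _ (by omega)]
    simp

lemma pow_succ_add_le_add_pow_succ {y a : ℝ} (hy : 0 ≤ y) (ha : 0 ≤ a) (i : ℕ) :
    y ^ (i + 1) + (i + 1) * a * y ^ i ≤ (y + a) ^ (i + 1) := by
  induction i with
  | zero => simp
  | succ i ih =>
    have h := mul_le_mul_of_nonneg_left ih (add_nonneg hy ha)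
    have h2 : 0 ≤ (i + 1) * a * y ^ i * a := by positivity
    push_cast
    calc _ ≤ (y + a) * (y ^ (i + 1) + (i + 1) * a * y ^ i) := by
          ring_nf at h2 ⊢; linarith
      _ ≤ _ := h
      _ = _ := by ring

lemma add_pow_succ_le_pow_succ_add {z a : ℝ} (hz : 0 ≤ z) (ha : 0 ≤ a) (i : ℕ) :
    (z + a) ^ (i + 1) ≤ z ^ (i + 1) + (i + 1) * a * (z + a) ^ i := by
  induction i with
  | zero => simp
  | succ i ih =>
    have h := mul_le_mul_of_nonneg_left ih (add_nonneg hz ha)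
    have h2 : a * z ^ (i + 1) ≤ a * (z + a) ^ (i + 1) := by gcongr; linarith
    push_cast
    calc (z + a) ^ (i + 1 + 1) = (z + a) * (z + a) ^ (i + 1) := by ring
      _ ≤ _ := h
      _ = z ^ (i + 1 + 1) + a * z ^ (i + 1) + (i + 1) * a * (z + a) ^ (i + 1) := by ring
      _ ≤ z ^ (i + 1 + 1) + a * (z + a) ^ (i + 1) + (i + 1) * a * (z + a) ^ (i + 1) := by gcongr
      _ = _ := by ring

lemma div_factorial_succ_div (x : ℝ) {a : ℝ} (i : ℕ) :
    x / (i + 1).factorial / a = x / ((i + 1) * a) / i.factorial := by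
  rw [Nat.factorial_succ, div_div, div_div]
  push_cast
  congr 1
  ring

lemma pow_div_factorial_add_le {y a : ℝ} (hy : 0 ≤ y) (ha : 0 < a) (i : ℕ) :
    y ^ i / i.factorial + y ^ (i + 1) / (i + 1).factorial / a ≤
      (y + a) ^ (i + 1) / (i + 1).factorial / a := by
  rw [div_factorial_succ_div, div_factorial_succ_div, ← add_div]
  gcongr
  rw [← sub_nonneg]
  have := pow_succ_add_le_add_pow_succ hy ha.le i
  have h : (y + a) ^ (i + 1) / ((i + 1) * a) - (y ^ i + y ^ (i + 1) / ((i + 1) * a)) =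
    ((y + a) ^ (i + 1) - (y ^ (i + 1) + (i + 1) * a * y ^ i)) / ((i + 1) * a) := by
    field_simp
    ring
  rw [h]
  exact div_nonneg (by linarith) (by positivity)

lemma add_pow_div_factorial_le {z a : ℝ} (hz : 0 ≤ z) (ha : 0 < a) (i : ℕ) :
    (z + a) ^ (i + 1) / (i + 1).factorial / a ≤
      (z + a) ^ i / i.factorial + z ^ (i + 1) / (i + 1).factorial / a := by
  rw [div_factorial_succ_div, div_factorial_succ_div, ← add_div]
  gcongr
  rw [← sub_nonneg]
  have := add_pow_succ_le_pow_succ_add hz ha.le i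
  have h : (z + a) ^ i + z ^ (i + 1) / ((i + 1) * a) - (z + a) ^ (i + 1) / ((i + 1) * a) =
    (z ^ (i + 1) + (i + 1) * a * (z + a) ^ i - (z + a) ^ (i + 1)) / ((i + 1) * a) := by
    field_simp
    ring
  rw [h]
  exact div_nonneg (by linarith) (by positivity)

lemma pow_succ_div_factorial_le {y a : ℝ} (hy : 0 ≤ y) (hya : y ≤ a) (ha : 0 < a) (i : ℕ) :
    y ^ (i + 1) / (i + 1).factorial / a ≤ y ^ i / i.factorial := by
  rw [div_factorial_succ_div]
  gcongr
  rw [div_le_iff₀ (by positivity), pow_succ]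
  gcongr
  nlinarith [Nat.cast_nonneg (α := ℝ) i]

open PowerSeries in
/-- Dividing a power series by `1 - X ^ a` integrates lower bounds on its coefficients. -/
lemma le_coeff_of_mul_one_sub_X_pow {F G : PowerSeries ℝ} {a : ℕ} (ha : 0 < a)
    (h : G * (1 - X ^ a) = F) {C E s : ℝ} (hC : 0 ≤ C) (hE : 0 ≤ E) (hs : 0 ≤ s) {i j : ℕ}
    (hF : ∀ n : ℕ, C * ((n : ℝ) ^ j / j.factorial) - E * ((n + s) ^ i / i.factorial) ≤ coeff n F)
    (n : ℕ) :
    C / a * ((n : ℝ) ^ (j + 1) / (j + 1).factorial) -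
      E / a * ((n + (s + a)) ^ (i + 1) / (i + 1).factorial) ≤ coeff n G := by
  have ha' : (0 : ℝ) < a := by exact_mod_cast ha
  induction n using Nat.strong_induction_on with
  | _ n ih =>
  rw [coeff_eq_of_mul_one_sub_X_pow h n]
  have hFn := hF n
  have h1 := mul_le_mul_of_nonneg_left
    (pow_div_factorial_add_le (y := n + s) (a := a) (by positivity) ha' i) hE
  have h0 : 0 ≤ E * ((n + s) ^ (i + 1) / (i + 1).factorial / a) := by positivity
  have e1 : ∀ x : ℝ, E / a * x = E * (x / a) := fun x => by ring
  have e2 : ∀ x : ℝ, C / a * x = C * (x / a) := fun x => by ring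
  rw [e1, e2, ← add_assoc]
  split_ifs with hn
  · have ihn := ih (n - a) (by omega)
    have hz : (0 : ℝ) ≤ n - a := by
      rw [sub_nonneg]; exact_mod_cast hn
    rw [e1, e2, Nat.cast_sub hn, show (n : ℝ) - a + (s + a) = n + s by ring] at ihn
    have h2 := mul_le_mul_of_nonneg_left (add_pow_div_factorial_le hz ha' j) hC
    rw [sub_add_cancel] at h2
    linarith
  · have h2 := mul_le_mul_of_nonneg_left (pow_succ_div_factorial_le (y := n) (a := a)
      (by positivity) (by exact_mod_cast (not_le.mp hn).le) ha' j) hC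
    linarith

open PowerSeries in
lemma le_coeff_of_iterate {F : ℕ → PowerSeries ℝ} {a : ℕ → ℕ} (hpos : ∀ i, 0 < a i)
    (h : ∀ m, F (m + 1) * (1 - X ^ a m) = F m) {C E s : ℝ} (hC : 0 ≤ C) (hE : 0 ≤ E)
    (hs : 0 ≤ s) {i j : ℕ} (m : ℕ)
    (hF : ∀ n : ℕ, C * ((n : ℝ) ^ j / j.factorial) - E * ((n + s) ^ i / i.factorial) ≤
      coeff n (F m)) (d n : ℕ) :
    C / (∏ l ∈ Finset.range d, (a (m + l) : ℝ)) * ((n : ℝ) ^ (j + d) / (j + d).factorial) -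
      E / (∏ l ∈ Finset.range d, (a (m + l) : ℝ)) *
        ((n + (s + ∑ l ∈ Finset.range d, (a (m + l) : ℝ))) ^ (i + d) / (i + d).factorial) ≤
      coeff n (F (m + d)) := by
  induction d generalizing n with
  | zero => simpa using hF n
  | succ d ih =>
    have := le_coeff_of_mul_one_sub_X_pow (hpos (m + d)) (h (m + d)) (by positivity)
      (by positivity) (by positivity) ih n
    rw [Finset.prod_range_succ, Finset.sum_range_succ, ← div_div, ← div_div]
    simpa only [add_assoc] using this

open PowerSeries in
lemma coeff_le_of_mul_one_sub_X_pow {F G : PowerSeries ℝ} {a : ℕ} (ha : 0 < a)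
    (h : G * (1 - X ^ a) = F) {E s : ℝ} (hE : 0 ≤ E) (hs : 0 ≤ s) {i : ℕ}
    (hF : ∀ n : ℕ, coeff n F ≤ E * ((n + s) ^ i / i.factorial)) (n : ℕ) :
    coeff n G ≤ E / a * ((n + (s + a)) ^ (i + 1) / (i + 1).factorial) := by
  have := le_coeff_of_mul_one_sub_X_pow (F := -F) (G := -G) ha (by rw [neg_mul, h]) le_rfl hE hs
    (i := i) (j := 0) (fun n => by simpa using hF n) n
  simpa using this

open PowerSeries in
lemma coeff_le_of_iterate {F : ℕ → PowerSeries ℝ} {a : ℕ → ℕ} (hpos : ∀ i, 0 < a i)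
    (h : ∀ m, F (m + 1) * (1 - X ^ a m) = F m) {E s : ℝ} (hE : 0 ≤ E)
    (hs : 0 ≤ s) {i : ℕ} (m : ℕ)
    (hF : ∀ n : ℕ, coeff n (F m) ≤ E * ((n + s) ^ i / i.factorial)) (d n : ℕ) :
    coeff n (F (m + d)) ≤ E / (∏ l ∈ Finset.range d, (a (m + l) : ℝ)) *
        ((n + (s + ∑ l ∈ Finset.range d, (a (m + l) : ℝ))) ^ (i + d) / (i + d).factorial) := by
  have := le_coeff_of_iterate (F := fun m => -F m) hpos (fun m => by rw [neg_mul, h]) le_rfl hE hs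
    (i := i) (j := 0) m (fun n => by simpa using hF n) d n
  simpa using this

open Polynomial in
lemma geom_sum_dvd {a b : ℕ} (hab : a ∣ b) :
    (∑ i ∈ Finset.range a, (X : ℝ[X]) ^ i) ∣ ∑ i ∈ Finset.range b, (X : ℝ[X]) ^ i := by
  obtain ⟨c, rfl⟩ := hab
  have h1 := geom_sum_mul_neg (X : ℝ[X]) a
  have h2 := geom_sum_mul_neg (X ^ a : ℝ[X]) c
  have h3 := geom_sum_mul_neg (X : ℝ[X]) (a * c)
  have hX : (1 - X : ℝ[X]) ≠ 0 := sub_ne_zero.mpr fun h => by simpa using congrArg (eval 0) h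
  refine ⟨∑ i ∈ Finset.range c, (X ^ a : ℝ[X]) ^ i, mul_right_cancel₀ hX ?_⟩
  rw [h3, mul_right_comm, h1, mul_comm (1 - X ^ a), h2, pow_mul]

open Polynomial in
lemma isCoprime_geom_sum {a b : ℕ} (hab : a.Coprime b) :
    IsCoprime (∑ i ∈ Finset.range a, (X : ℝ[X]) ^ i) (∑ i ∈ Finset.range b, (X : ℝ[X]) ^ i) := by
  rcases lt_trichotomy b 1 with hb | rfl | hb
  · obtain rfl : b = 0 := by omega
    obtain rfl : a = 1 := by simpa using hab
    simpa using isCoprime_one_left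
  · simpa using isCoprime_one_right
  · obtain ⟨m, -, hm⟩ := Nat.exists_mul_mod_eq_one_of_coprime hab hb
    have h1 : a * m = b * (a * m / b) + 1 := by rw [← hm, Nat.div_add_mod]
    obtain ⟨u, hu⟩ := geom_sum_dvd (Dvd.intro m rfl : a ∣ a * m)
    obtain ⟨v, hv⟩ := geom_sum_dvd (Dvd.intro (a * m / b) rfl : b ∣ b * (a * m / b))
    rw [h1, geom_sum_succ, hv] at hu
    exact ⟨u, -(X * v), by linear_combination -hu⟩

open Polynomial in
lemma exists_prod_geom_sum_mul {a : ℕ → ℕ} (hpos : ∀ i, 0 < a i)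
    (hgcd : ∀ i j, i < j → j < 4 → Nat.gcd (a i) (a j) = 1) :
    ∃ T : ℝ[X], T.natDegree < ∏ i ∈ Finset.range 4, a i ∧ T.eval 1 = 1 ∧
      (∏ i ∈ Finset.range 4, ∑ l ∈ Finset.range (a i), (X : ℝ[X]) ^ l) * T =
        ∑ l ∈ Finset.range (∏ i ∈ Finset.range 4, a i), (X : ℝ[X]) ^ l := by
  obtain ⟨T, hT⟩ : (∏ i ∈ Finset.range 4, ∑ l ∈ Finset.range (a i), (X : ℝ[X]) ^ l) ∣
        ∑ l ∈ Finset.range (∏ i ∈ Finset.range 4, a i), (X : ℝ[X]) ^ l := by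
    refine Finset.prod_dvd_of_coprime (fun i hi j hj hij => ?_)
      fun i hi => geom_sum_dvd (Finset.dvd_prod_of_mem _ hi)
    simp only [Finset.coe_range, Set.mem_Iio] at hi hj
    rcases lt_or_gt_of_ne hij with h | h
    · exact isCoprime_geom_sum (hgcd i j h hj)
    · exact (isCoprime_geom_sum (hgcd j i h hi)).symm
  have hLpos : 0 < ∏ i ∈ Finset.range 4, a i := Finset.prod_pos fun i _ => hpos i
  have hR : (∏ i ∈ Finset.range 4, (a i : ℝ)) ≠ 0 :=
    Finset.prod_ne_zero_iff.mpr fun i _ => by exact_mod_cast (hpos i).ne'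
  have hev : T.eval 1 = 1 := by
    have := congrArg (eval 1) hT
    simp only [eval_mul, eval_prod, eval_geom_sum, one_pow, Finset.sum_const, Finset.card_range,
      nsmul_eq_mul, mul_one, Nat.cast_prod] at this
    exact (mul_left_cancel₀ hR (by rw [mul_one]; exact this)).symm
  refine ⟨T, ?_, hev, hT.symm⟩
  have hT0 : T ≠ 0 := by rintro rfl; simp at hev
  have hne : ∑ l ∈ Finset.range (∏ i ∈ Finset.range 4, a i), (X : ℝ[X]) ^ l ≠ 0 := by
    intro h0
    have := congrArg (eval 1) h0
    simp [eval_geom_sum] at this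
    simp [Finset.prod_eq_zero_iff, (hpos _).ne'] at this
  have hdeg : T.natDegree ≤ _ := natDegree_le_of_dvd ⟨_, hT.trans (mul_comm _ _)⟩ hne
  refine hdeg.trans_lt ?_
  refine (natDegree_sum_le_of_forall_le (n := ∏ i ∈ Finset.range 4, a i - 1) _ _ fun l hl => ?_).trans_lt (by omega)
  rw [natDegree_X_pow]
  have := Finset.mem_range.mp hl
  omega

open PowerSeries in
lemma pASeries_mul_prod {a : ℕ → ℕ} (hpos : ∀ i, 0 < a i) (k : ℕ) :
    pASeries a k * ∏ i ∈ Finset.range k, (1 - X ^ a i) = 1 := by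
  induction k with
  | zero => simp [pASeries_zero]
  | succ k ih =>
    rw [Finset.prod_range_succ, mul_comm (Finset.prod _ _), ← mul_assoc, pASeries_succ hpos, ih]

open PowerSeries in
/-- The second difference of `n ↦ pA a 4 n` increases by `1` over each period. -/
lemma coeff_add_prod_eq {a : ℕ → ℕ} (hpos : ∀ i, 0 < a i)
    (hgcd : ∀ i j, i < j → j < 4 → Nat.gcd (a i) (a j) = 1) (n : ℕ) :
    coeff (n + ∏ i ∈ Finset.range 4, a i) (pASeries a 4 * (1 - X) ^ 2) =
      coeff n (pASeries a 4 * (1 - X) ^ 2) + 1 := by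
  obtain ⟨T, hdeg, hev, hT⟩ := exists_prod_geom_sum_mul hpos hgcd
  set L := ∏ i ∈ Finset.range 4, a i with hL
  have hT' := congrArg (fun p : Polynomial ℝ => (p : PowerSeries ℝ)) hT
  have hcoe : ∀ m : ℕ, ((∑ l ∈ Finset.range m, (Polynomial.X : Polynomial ℝ) ^ l :
      Polynomial ℝ) : PowerSeries ℝ) = ∑ l ∈ Finset.range m, (X : PowerSeries ℝ) ^ l := fun m => by
    have := map_sum (Polynomial.coeToPowerSeries.ringHom (R := ℝ))
      (fun l => (Polynomial.X : Polynomial ℝ) ^ l) (Finset.range m)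
    simp only [Polynomial.coeToPowerSeries.ringHom_apply, Polynomial.coe_pow,
      Polynomial.coe_X] at this
    exact this
  have hprod : ((∏ i ∈ Finset.range 4, ∑ l ∈ Finset.range (a i), (Polynomial.X : Polynomial ℝ) ^ l :
      Polynomial ℝ) : PowerSeries ℝ) =
      ∏ i ∈ Finset.range 4, ∑ l ∈ Finset.range (a i), (X : PowerSeries ℝ) ^ l := by
    have := map_prod (Polynomial.coeToPowerSeries.ringHom (R := ℝ))
      (fun i => ∑ l ∈ Finset.range (a i), (Polynomial.X : Polynomial ℝ) ^ l) (Finset.range 4)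
    simp only [Polynomial.coeToPowerSeries.ringHom_apply, hcoe] at this
    exact this
  simp only [Polynomial.coe_mul, hcoe, hprod] at hT'
  have hP := pASeries_mul_prod hpos 4
  simp only [← geom_sum_mul_neg (X : PowerSeries ℝ), Finset.prod_mul_distrib, Finset.prod_const,
    Finset.card_range] at hP
  have hone := mk_one_mul_one_sub_eq_one ℝ
  have key : pASeries a 4 * (1 - X) ^ 2 * (1 - X ^ L) = (T : PowerSeries ℝ) * mk 1 := by
    rw [← geom_sum_mul_neg, ← hT']
    set Q := ∏ i ∈ Finset.range 4, ∑ l ∈ Finset.range (a i), (X : PowerSeries ℝ) ^ l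
    linear_combination (-pASeries a 4 * (1 - X) ^ 3 * Q * T) * hone + (T : PowerSeries ℝ) * mk 1 * hP
  have hc : coeff (n + L) ((T : PowerSeries ℝ) * mk 1) = 1 := by
    rw [coeff_mul, Finset.Nat.sum_antidiagonal_eq_sum_range_succ_mk, ← hev,
      Polynomial.eval_eq_sum_range' (n := n + L + 1) (by omega)]
    simp
  rw [coeff_eq_of_mul_one_sub_X_pow key, hc, if_pos (by omega), Nat.add_sub_cancel]
  ring

lemma abs_sub_div_le_of_add_eq {v : ℕ → ℝ} {L : ℕ} (hL : 0 < L) (h : ∀ n, v (n + L) = v n + 1)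
    {B : ℝ} (hB : ∀ n < L, |v n - n / L| ≤ B) (n : ℕ) : |v n - n / L| ≤ B := by
  induction n using Nat.strong_induction_on with
  | _ n ih =>
  rcases lt_or_ge n L with hn | hn
  · exact hB n hn
  · have h1 := ih (n - L) (by omega)
    have h2 := h (n - L)
    have hL' : (L : ℝ) ≠ 0 := by exact_mod_cast hL.ne'
    rw [Nat.sub_add_cancel hn] at h2
    rw [Nat.cast_sub hn, sub_div, div_self hL'] at h1
    rwa [h2, show v (n - L) + 1 - n / L = v (n - L) - (n / L - 1) by ring]

open PowerSeries in
lemma pA_one_le {a : ℕ → ℕ} (hpos : ∀ i, 0 < a i) (n : ℕ) : coeff n (pASeries a 1) ≤ 1 := by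
  induction n using Nat.strong_induction_on with
  | _ n ih =>
  rw [coeff_eq_of_mul_one_sub_X_pow (pASeries_succ hpos 0), pASeries_zero, coeff_one]
  have := hpos 0
  split_ifs with h1 h2 h2
  · omega
  · simp
  · simpa using ih (n - a 0) (by omega)
  · simp

open PowerSeries in
lemma pA_four_le {a : ℕ → ℕ} (hpos : ∀ i, 0 < a i) (n : ℕ)
    (hn : n < ∏ i ∈ Finset.range 4, a i) :
    coeff n (pASeries a 4) ≤ 11 * (∏ i ∈ Finset.range 4, (a i : ℝ)) ^ 2 * a 0 := by
  have h := coeff_le_of_iterate hpos (pASeries_succ hpos) (E := 1) (s := 0) zero_le_one le_rfl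
    (i := 0) 1 (fun n => by simpa using pA_one_le hpos n) 3 n
  have hn' : (n : ℝ) ≤ ∏ i ∈ Finset.range 4, (a i : ℝ) := by exact_mod_cast hn.le
  simp only [Finset.prod_range_succ, Finset.sum_range_succ, Finset.prod_range_zero,
    Finset.sum_range_zero] at h hn' ⊢
  norm_num [Nat.factorial] at h hn' ⊢
  have h0 : (1 : ℝ) ≤ a 0 := by exact_mod_cast hpos 0
  have h1 : (1 : ℝ) ≤ a 1 := by exact_mod_cast hpos 1
  have h2 : (1 : ℝ) ≤ a 2 := by exact_mod_cast hpos 2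
  have h3 : (1 : ℝ) ≤ a 3 := by exact_mod_cast hpos 3
  generalize (a 0 : ℝ) = x at *
  generalize (a 1 : ℝ) = y at *
  generalize (a 2 : ℝ) = z at *
  generalize (a 3 : ℝ) = w at *
  refine h.trans ?_
  have hy : y ≤ x * y * z * w := by
    calc y = 1 * y * 1 * 1 := by ring
      _ ≤ _ := by gcongr
  have hz : z ≤ x * y * z * w := by
    calc z = 1 * 1 * z * 1 := by ring
      _ ≤ _ := by gcongr
  have hw : w ≤ x * y * z * w := by
    calc w = 1 * 1 * 1 * w := by ring
      _ ≤ _ := by gcongr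
  have hS : (n : ℝ) + (y + z + w) ≤ 4 * (x * y * z * w) := by linarith
  calc _ ≤ w⁻¹ * (z⁻¹ * y⁻¹) * ((4 * (x * y * z * w)) ^ 3 / 6) := by gcongr
    _ = 64 / 6 * ((x * y * z * w) ^ 2 * x) := by field_simp; norm_num
    _ ≤ 11 * ((x * y * z * w) ^ 2 * x) := by gcongr; norm_num
    _ = _ := by ring

open PowerSeries in
lemma abs_second_difference_sub_le {a : ℕ → ℕ} (hpos : ∀ i, 0 < a i)
    (hgcd : ∀ i j, i < j → j < 4 → Nat.gcd (a i) (a j) = 1) (n : ℕ) :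
    |coeff n (pASeries a 4 * (1 - X) ^ 2) - n / (∏ i ∈ Finset.range 4, (a i : ℝ))| ≤
      23 * (∏ i ∈ Finset.range 4, (a i : ℝ)) ^ 2 * a 0 := by
  have hLpos : 0 < ∏ i ∈ Finset.range 4, a i := Finset.prod_pos fun i _ => hpos i
  rw [← Nat.cast_prod]
  refine abs_sub_div_le_of_add_eq (v := fun n => coeff n (pASeries a 4 * (1 - X) ^ 2)) hLpos
    (coeff_add_prod_eq hpos hgcd) (fun n hn => ?_) n
  have hL1 : (1 : ℝ) ≤ (∏ i ∈ Finset.range 4, a i : ℕ) := by exact_mod_cast hLpos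
  have ha1 : (1 : ℝ) ≤ a 0 := by exact_mod_cast hpos 0
  have hB1 : (1 : ℝ) ≤ ((∏ i ∈ Finset.range 4, a i : ℕ) : ℝ) ^ 2 * a 0 := by
    nlinarith [one_le_pow₀ hL1 (n := 2)]
  have hbd : ∀ m ≤ n, 0 ≤ coeff m (pASeries a 4) ∧ coeff m (pASeries a 4) ≤
      11 * ((∏ i ∈ Finset.range 4, a i : ℕ) : ℝ) ^ 2 * a 0 := fun m hm => by
    refine ⟨by simp [pASeries], ?_⟩
    have := pA_four_le hpos m (by omega)
    exact_mod_cast this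
  have hv : coeff n (pASeries a 4 * (1 - X) ^ 2) = coeff n (pASeries a 4) -
      2 * (if 1 ≤ n then coeff (n - 1) (pASeries a 4) else 0) +
      (if 2 ≤ n then coeff (n - 2) (pASeries a 4) else 0) := by
    rw [show pASeries a 4 * (1 - X) ^ 2 = pASeries a 4 - C (2 : ℝ) * (pASeries a 4 * X ^ 1) +
      pASeries a 4 * X ^ 2 by rw [map_ofNat]; ring, map_add, map_sub, coeff_C_mul,
      coeff_mul_X_pow', coeff_mul_X_pow']
  have hq0 : 0 ≤ (n : ℝ) / (∏ i ∈ Finset.range 4, a i : ℕ) := by positivity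
  have hq1 : (n : ℝ) / (∏ i ∈ Finset.range 4, a i : ℕ) ≤ 1 := by
    rw [div_le_one (by linarith)]; exact_mod_cast hn.le
  rw [hv, abs_le]
  have b0 := hbd n le_rfl
  have b1 := hbd (n - 1) (by omega)
  have b2 := hbd (n - 2) (by omega)
  constructor <;> split_ifs <;> linarith

open PowerSeries in
lemma pASeries_mul_succ {a : ℕ → ℕ} (hpos : ∀ i, 0 < a i) (e m : ℕ) :
    pASeries a (m + 1) * (1 - X) ^ e * (1 - X ^ a m) = pASeries a m * (1 - X) ^ e := by
  rw [mul_right_comm, pASeries_succ hpos]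

/-- The constant governing the error terms in the estimates for `pA`. -/
noncomputable def errorConst (a : ℕ → ℕ) : ℝ :=
  23 * (∏ i ∈ Finset.range 4, (a i : ℝ)) ^ 3 * a 0

lemma errorConst_nonneg (a : ℕ → ℕ) : 0 ≤ errorConst a := by
  unfold errorConst; positivity

lemma prod_range_four_pos {a : ℕ → ℕ} (hpos : ∀ i, 0 < a i) : 0 < ∏ i ∈ Finset.range 4, (a i : ℝ) :=
  Finset.prod_pos fun i _ => by exact_mod_cast hpos i

open PowerSeries in
lemma second_difference_four_le {a : ℕ → ℕ} (hpos : ∀ i, 0 < a i)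
    (hgcd : ∀ i j, i < j → j < 4 → Nat.gcd (a i) (a j) = 1) (n : ℕ) :
    coeff n (pASeries a 4 * (1 - X) ^ 2) ≤ 1 / (∏ i ∈ Finset.range 4, (a i : ℝ)) *
      ((n + errorConst a) ^ 1 / Nat.factorial 1) := by
  have h := (abs_le.mp (abs_second_difference_sub_le hpos hgcd n)).2
  have hL := prod_range_four_pos hpos
  have e : 1 / (∏ i ∈ Finset.range 4, (a i : ℝ)) * ((n + errorConst a) ^ 1 / Nat.factorial 1) =
      n / (∏ i ∈ Finset.range 4, (a i : ℝ)) +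
        23 * (∏ i ∈ Finset.range 4, (a i : ℝ)) ^ 2 * a 0 := by
    rw [errorConst]
    field_simp
    simp
  rw [e]
  linarith

open PowerSeries in
lemma le_second_difference_four {a : ℕ → ℕ} (hpos : ∀ i, 0 < a i)
    (hgcd : ∀ i j, i < j → j < 4 → Nat.gcd (a i) (a j) = 1) (n : ℕ) :
    1 / (∏ i ∈ Finset.range 4, (a i : ℝ)) * ((n : ℝ) ^ 1 / Nat.factorial 1) -
      errorConst a / (∏ i ∈ Finset.range 4, (a i : ℝ)) * ((n + 0 : ℝ) ^ 0 / Nat.factorial 0) ≤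
    coeff n (pASeries a 4 * (1 - X) ^ 2) := by
  have h := (abs_le.mp (abs_second_difference_sub_le hpos hgcd n)).1
  have hL := prod_range_four_pos hpos
  have e : 1 / (∏ i ∈ Finset.range 4, (a i : ℝ)) * ((n : ℝ) ^ 1 / Nat.factorial 1) -
      errorConst a / (∏ i ∈ Finset.range 4, (a i : ℝ)) * ((n + 0 : ℝ) ^ 0 / Nat.factorial 0) =
      n / (∏ i ∈ Finset.range 4, (a i : ℝ)) -
        23 * (∏ i ∈ Finset.range 4, (a i : ℝ)) ^ 2 * a 0 := by
    rw [errorConst]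
    field_simp
    simp
  rw [e]
  linarith

open PowerSeries in
lemma second_difference_le {a : ℕ → ℕ} (hpos : ∀ i, 0 < a i)
    (hgcd : ∀ i j, i < j → j < 4 → Nat.gcd (a i) (a j) = 1) (d n : ℕ) :
    coeff n (pASeries a (4 + d) * (1 - X) ^ 2) ≤
      1 / (∏ i ∈ Finset.range (4 + d), (a i : ℝ)) *
      ((n + (errorConst a + ∑ l ∈ Finset.range d, (a (4 + l) : ℝ))) ^ (1 + d) /
        (1 + d).factorial) := by
  have hL := prod_range_four_pos hpos
  rw [Finset.prod_range_add, ← div_div]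
  exact coeff_le_of_iterate hpos (F := fun m => pASeries a m * (1 - X) ^ 2)
    (pASeries_mul_succ hpos 2) (by positivity) (errorConst_nonneg a) 4
    (second_difference_four_le hpos hgcd) d n

open PowerSeries in
lemma coeff_pASeries_le {a : ℕ → ℕ} (hpos : ∀ i, 0 < a i)
    (hgcd : ∀ i j, i < j → j < 4 → Nat.gcd (a i) (a j) = 1) (d n : ℕ) :
    coeff n (pASeries a (4 + d)) ≤
      1 / (∏ i ∈ Finset.range (4 + d), (a i : ℝ)) *
      ((n + (errorConst a + 1 + 1 + ∑ l ∈ Finset.range d, (a (4 + l) : ℝ))) ^ (3 + d) /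
        (3 + d).factorial) := by
  have hL := prod_range_four_pos hpos
  have hs := errorConst_nonneg a
  have h1 := coeff_le_of_mul_one_sub_X_pow (G := pASeries a 4 * (1 - X)) (a := 1) one_pos
    (by ring) (by positivity) hs (second_difference_four_le hpos hgcd)
  have h2 := coeff_le_of_mul_one_sub_X_pow (G := pASeries a 4) (a := 1) one_pos
    (by ring) (by positivity) (by positivity) h1
  simp only [Nat.cast_one, div_one] at h2
  rw [Finset.prod_range_add, ← div_div]
  exact coeff_le_of_iterate hpos (F := fun m => pASeries a m)
    (pASeries_succ hpos) (by positivity) (by positivity) 4 h2 d n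

open PowerSeries in
lemma le_first_difference {a : ℕ → ℕ} (hpos : ∀ i, 0 < a i)
    (hgcd : ∀ i j, i < j → j < 4 → Nat.gcd (a i) (a j) = 1) (d n : ℕ) :
    1 / (∏ i ∈ Finset.range (4 + d), (a i : ℝ)) * ((n : ℝ) ^ (2 + d) / (2 + d).factorial) -
      errorConst a / (∏ i ∈ Finset.range (4 + d), (a i : ℝ)) *
      ((n + (1 + ∑ l ∈ Finset.range d, (a (4 + l) : ℝ))) ^ (1 + d) / (1 + d).factorial) ≤
    coeff n (pASeries a (4 + d) * (1 - X)) := by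
  have hL := prod_range_four_pos hpos
  have hs := errorConst_nonneg a
  have h1 := le_coeff_of_mul_one_sub_X_pow (G := pASeries a 4 * (1 - X) ^ 1) (a := 1) one_pos
    (by ring) (by positivity) (by positivity) le_rfl (le_second_difference_four hpos hgcd)
  simp only [Nat.cast_one, div_one, zero_add] at h1
  rw [Finset.prod_range_add, ← div_div, ← div_div, ← pow_one (1 - X : PowerSeries ℝ)]
  exact le_coeff_of_iterate hpos (F := fun m => pASeries a m * (1 - X) ^ 1)
    (pASeries_mul_succ hpos 1) (by positivity) (by positivity) zero_le_one 4 h1 d n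

lemma add_pow_le_of_hundred_mul_le {n S : ℝ} {k j : ℕ} (hk : 0 < k) (hj : j ≤ k) (hS : 0 ≤ S)
    (hn0 : 0 < n) (hn : 100 * (k : ℝ) ^ 2 * S ≤ n) :
    (n + S) ^ j ≤ n ^ j * (1 + 1 / (50 * k)) := by
  have hk' : (1 : ℝ) ≤ k := by exact_mod_cast hk
  have h1 : (n + S) ^ j = n ^ j * (1 + S / n) ^ j := by
    rw [← mul_pow]; congr 1; field_simp
  rw [h1]
  gcongr
  have h2 : S / n ≤ 1 / (100 * k ^ 2) := by
    rw [div_le_div_iff₀ hn0 (by positivity)]; linarith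
  have hq : (0 : ℝ) ≤ S / n := by positivity
  have h3 : (j : ℝ) * (S / n) ≤ 1 / (100 * k) := by
    calc (j : ℝ) * (S / n) ≤ k * (1 / (100 * k ^ 2)) := by gcongr
      _ = _ := by field_simp
  have h4 : (1 : ℝ) / (100 * k) ≤ 1 := by
    rw [div_le_one (by positivity)]; linarith
  calc (1 + S / n) ^ j ≤ Real.exp (S / n) ^ j := by
        gcongr
        linarith [Real.add_one_le_exp (S / n)]
    _ = Real.exp (j * (S / n)) := by rw [← Real.exp_nat_mul]
    _ ≤ Real.exp (1 / (100 * k)) := Real.exp_le_exp.mpr h3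
    _ ≤ 1 + 1 / (50 * k) := by
      have := Real.abs_exp_sub_one_le (x := 1 / (100 * (k : ℝ)))
        (by rw [abs_of_nonneg (by positivity)]; exact h4)
      rw [abs_of_nonneg (show (0 : ℝ) ≤ 1 / (100 * k) by positivity)] at this
      have h5 := (abs_le.mp this).2
      have e : (1 : ℝ) / (50 * k) = 2 * (1 / (100 * k)) := by field_simp; norm_num
      linarith

lemma sub_one_mul_sub_two_add_one_mul_lt {k ε : ℝ} (hk : 5 ≤ k) (hε0 : 0 ≤ ε)
    (hε1 : ε ≤ 1 / 250) (hεk : ε * k = 1 / 50) :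
    ((k - 1) * (k - 2) + 1) * (1 + ε) ^ 2 < ((k - 1) * (1 - ε)) ^ 2 := by
  have h5 : (1 + ε) ^ 2 ≤ 1 + 3 * ε := by nlinarith
  have h6 : 1 - 2 * ε ≤ (1 - ε) ^ 2 := by nlinarith
  have h7 : (k - 1) ^ 2 * (1 - 2 * ε) - ((k - 1) * (k - 2) + 1) * (1 + 3 * ε) =
      k - 2 - k / 10 + 13 / 50 - 11 * ε := by linear_combination (13 - 5 * k) * hεk
  have h8 : 0 ≤ (k - 1) * (k - 2) + 1 := by nlinarith
  calc ((k - 1) * (k - 2) + 1) * (1 + ε) ^ 2 ≤ ((k - 1) * (k - 2) + 1) * (1 + 3 * ε) := by gcongr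
    _ < (k - 1) ^ 2 * (1 - 2 * ε) := by linarith
    _ ≤ (k - 1) ^ 2 * (1 - ε) ^ 2 := by gcongr
    _ = _ := by ring

lemma log_concave_of_bounds {p q r M N n k : ℝ} (hk : 5 ≤ k) (hM : 0 < M) (hN : 0 < N)
    (hn : 0 < n) (hq0 : 0 ≤ q) (hp0 : 0 ≤ p)
    (hp : M * p ≤ N * n ^ 2 * (1 + 1 / (50 * k)))
    (hq : M * q ≤ N * n ^ 2 * (1 + 1 / (50 * k)))
    (hd : (k - 1) * N * n * (1 - 1 / (50 * k)) ≤ M * (p - q))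
    (hD : M * (r - 2 * p + q) ≤ (k - 1) * (k - 2) * N * (1 + 1 / (50 * k))) :
    (1 + 1 / n ^ 2) * r * q < p ^ 2 := by
  set ε := 1 / (50 * k) with hε
  have hεk : ε * k = 1 / 50 := by rw [hε]; field_simp
  have hε0 : 0 < ε := by rw [hε]; positivity
  have hε1 : ε ≤ 1 / 250 := by nlinarith
  obtain ⟨x, rfl⟩ : ∃ x, p = N * n ^ 2 / M * x := ⟨p / (N * n ^ 2 / M), by field_simp⟩
  obtain ⟨y, rfl⟩ : ∃ y, q = N * n ^ 2 / M * y := ⟨q / (N * n ^ 2 / M), by field_simp⟩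
  obtain ⟨t, ht⟩ : ∃ t, t = n * (x - y) := ⟨_, rfl⟩
  obtain ⟨D, hD'⟩ : ∃ D, D = M / N * (r - 2 * (N * n ^ 2 / M * x) + N * n ^ 2 / M * y) := ⟨_, rfl⟩
  have hc : 0 < N * n ^ 2 / M := by positivity
  have hr : r = N / M * (D + n ^ 2 * (2 * x - y)) := by rw [hD']; field_simp; ring
  have hy0 : 0 ≤ y := nonneg_of_mul_nonneg_right hq0 hc
  have hx0 : 0 ≤ x := nonneg_of_mul_nonneg_right hp0 hc
  have hx : x ≤ 1 + ε := by
    refine le_of_mul_le_mul_left (a := N * n ^ 2) (le_trans (le_of_eq ?_) hp) (by positivity)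
    field_simp
  have hy : y ≤ 1 + ε := by
    refine le_of_mul_le_mul_left (a := N * n ^ 2) (le_trans (le_of_eq ?_) hq) (by positivity)
    field_simp
  have hd : (k - 1) * (1 - ε) ≤ t := by
    refine le_of_mul_le_mul_left (a := N * n) (le_trans (le_of_eq ?_) (hd.trans (le_of_eq ?_)))
      (by positivity)
    · ring
    · rw [ht]; field_simp
  have hD : D ≤ (k - 1) * (k - 2) * (1 + ε) := by
    refine le_of_mul_le_mul_left (a := N) (le_trans (le_of_eq ?_) (hD.trans (le_of_eq ?_))) hN
    · rw [hD']; field_simp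
    · ring
  have key : x ^ 2 < t ^ 2 - y * D := by
    have h1 : ((k - 1) * (1 - ε)) ^ 2 ≤ t ^ 2 := by
      have : 0 ≤ (k - 1) * (1 - ε) := mul_nonneg (by linarith) (by linarith)
      gcongr
    have h2 : y * D ≤ (1 + ε) * ((k - 1) * (k - 2) * (1 + ε)) := by
      have : 0 ≤ (k - 1) * (k - 2) * (1 + ε) :=
        mul_nonneg (mul_nonneg (by linarith) (by linarith)) (by linarith)
      calc y * D ≤ y * ((k - 1) * (k - 2) * (1 + ε)) := by gcongr
        _ ≤ _ := by gcongr
    have h3 : x ^ 2 ≤ (1 + ε) ^ 2 := by gcongr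
    have h4 : ((k - 1) * (k - 2) + 1) * (1 + ε) ^ 2 < ((k - 1) * (1 - ε)) ^ 2 :=
      sub_one_mul_sub_two_add_one_mul_lt hk hε0.le hε1 hεk
    linarith
  have e1 : (N * n ^ 2 / M * x) ^ 2 - (1 + 1 / n ^ 2) * r * (N * n ^ 2 / M * y) =
      N ^ 2 * n ^ 2 / M ^ 2 * ((1 + 1 / n ^ 2) * (t ^ 2 - y * D) - x ^ 2) := by
    rw [hr, ht]
    field_simp
    ring
  have h8 : 0 ≤ 1 / n ^ 2 * (t ^ 2 - y * D) :=
    mul_nonneg (by positivity) (by nlinarith [sq_nonneg x])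
  have : 0 < N ^ 2 * n ^ 2 / M ^ 2 * ((1 + 1 / n ^ 2) * (t ^ 2 - y * D) - x ^ 2) :=
    mul_pos (by positivity) (by linarith)
  linarith

lemma hundred_mul_errorConst_le {a : ℕ → ℕ} (hpos : ∀ i, 0 < a i) (hmono : StrictMono a) {d : ℕ}
    (hd : 0 < d) :
    100 * ((4 + d : ℕ) : ℝ) ^ 2 *
        (errorConst a + 3 + ∑ l ∈ Finset.range d, (a (4 + l) : ℝ)) ≤
      2 * ((4 + d : ℕ) : ℝ) ^ 2 * (Nat.factorial (3 + d) : ℝ) * ((a 0 : ℝ) * a 1 * a 2) ^ 3 *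
          (a (3 + d) : ℝ) ^ (4 + d + 3) * Real.exp (1 / (a (3 + d) : ℝ)) := by
  have hK : ((4 + d : ℕ) : ℝ) ≤ a (3 + d) := by
    have h : ∀ i, i + 1 ≤ a i := fun i => by
      induction i with
      | zero => exact hpos 0
      | succ i ih => exact Nat.succ_le_of_lt (ih.trans_lt (hmono i.lt_succ_self))
    have := h (3 + d)
    exact_mod_cast (by omega : 4 + d ≤ a (3 + d))
  have hd1 : (1 : ℝ) ≤ d := by exact_mod_cast hd
  have ha3 : (a 3 : ℝ) ≤ a (3 + d) := by exact_mod_cast hmono.monotone (by omega)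
  have ha0 : (a 0 : ℝ) ≤ a (3 + d) := by exact_mod_cast hmono.monotone (by omega)
  have hsum : ∑ l ∈ Finset.range d, (a (4 + l) : ℝ) ≤ d * a (3 + d) := by
    have := Finset.sum_le_card_nsmul (Finset.range d) (fun l => (a (4 + l) : ℝ)) (a (3 + d))
      fun l hl => by
        have := Finset.mem_range.mp hl
        exact_mod_cast hmono.monotone (by omega)
    simpa using this
  have hfac : (24 : ℝ) ≤ (Nat.factorial (3 + d) : ℝ) := by
    exact_mod_cast (Nat.factorial_le (by omega : 4 ≤ 3 + d) : Nat.factorial 4 ≤ _)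
  have hG : (1 : ℝ) ≤ a 0 * a 1 * a 2 := by
    exact_mod_cast Nat.mul_pos (Nat.mul_pos (hpos 0) (hpos 1)) (hpos 2)
  have hexp : 1 ≤ Real.exp (1 / (a (3 + d) : ℝ)) := Real.one_le_exp (by positivity)
  push_cast at hK ⊢
  have hconst : errorConst a ≤ 23 * ((a 0 * a 1 * a 2 : ℝ) ^ 3 * (a (3 + d) : ℝ) ^ 4) := by
    simp only [errorConst, Finset.prod_range_succ, Finset.prod_range_zero, one_mul]
    calc _ ≤ 23 * ((a 0 : ℝ) * a 1 * a 2 * a (3 + d)) ^ 3 * a (3 + d) := by gcongr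
      _ = _ := by ring
  generalize (a 0 * a 1 * a 2 : ℝ) = G at *
  generalize (a (3 + d) : ℝ) = K at *
  have hK5 : 5 ≤ K := by linarith
  have hG3 : 1 ≤ G ^ 3 := one_le_pow₀ hG
  have hrest : 3 + ∑ l ∈ Finset.range d, (a (4 + l) : ℝ) ≤ G ^ 3 * K ^ 4 := by
    calc 3 + ∑ l ∈ Finset.range d, (a (4 + l) : ℝ) ≤ 3 + K * K := by
          gcongr; nlinarith
      _ ≤ 1 * K ^ 4 := by nlinarith [sq_nonneg (K ^ 2 - 2)]
      _ ≤ _ := by gcongr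
  have hK4 : 625 ≤ K ^ 4 := by
    calc (625 : ℝ) = 5 ^ 4 := by norm_num
      _ ≤ _ := by gcongr
  calc 100 * (4 + (d : ℝ)) ^ 2 * (errorConst a + 3 + ∑ l ∈ Finset.range d, (a (4 + l) : ℝ))
      ≤ 100 * (4 + (d : ℝ)) ^ 2 * (24 * (G ^ 3 * K ^ 4)) := by gcongr; linarith
    _ = 2 * (4 + (d : ℝ)) ^ 2 * 24 * G ^ 3 * (50 * K ^ 4) := by ring
    _ ≤ 2 * (4 + (d : ℝ)) ^ 2 * 24 * G ^ 3 * (K ^ 4 * K ^ 4) := by gcongr; linarith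
    _ = 2 * (4 + (d : ℝ)) ^ 2 * 24 * G ^ 3 * K ^ 8 * 1 := by ring
    _ ≤ 2 * (4 + (d : ℝ)) ^ 2 * (Nat.factorial (3 + d) : ℝ) * G ^ 3 * K ^ (4 + d + 3) *
        Real.exp (1 / K) := by
      gcongr
      · linarith
      · omega

open PowerSeries in
lemma pA_log_concave {a : ℕ → ℕ} (hpos : ∀ i, 0 < a i)
    (hgcd : ∀ i j, i < j → j < 4 → Nat.gcd (a i) (a j) = 1) {d : ℕ} (hd : 0 < d) {n : ℕ}
    (hn : 100 * ((4 + d : ℕ) : ℝ) ^ 2 *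
        (errorConst a + 3 + ∑ l ∈ Finset.range d, (a (4 + l) : ℝ)) ≤ n) :
    (1 + 1 / (n : ℝ) ^ 2) * (pA a (4 + d) ((n : ℤ) + 1) : ℝ) * (pA a (4 + d) ((n : ℤ) - 1) : ℝ) <
      (pA a (4 + d) (n : ℤ) : ℝ) ^ 2 := by
  set R := ∑ l ∈ Finset.range d, (a (4 + l) : ℝ) with hR
  have hR0 : 0 ≤ R := Finset.sum_nonneg fun _ _ => by positivity
  have hs := errorConst_nonneg a
  set S := errorConst a + 3 + R with hS
  have hS0 : 0 < S := by linarith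
  have hk5 : (5 : ℝ) ≤ (4 + d : ℕ) := by exact_mod_cast (by omega : 5 ≤ 4 + d)
  have hn0 : (0 : ℝ) < n := lt_of_lt_of_le (by positivity) hn
  obtain ⟨m, rfl⟩ : ∃ m, n = m + 1 := Nat.exists_eq_succ_of_ne_zero (by rintro rfl; simp at hn0)
  have hpow : ∀ j ≤ 4 + d, (((m + 1 : ℕ) : ℝ) + S) ^ j ≤
      ((m + 1 : ℕ) : ℝ) ^ j * (1 + 1 / (50 * ((4 + d : ℕ) : ℝ))) := fun j hj =>
    add_pow_le_of_hundred_mul_le (by omega) hj hS0.le hn0 hn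
  have hQ : 0 < ∏ i ∈ Finset.range (4 + d), (a i : ℝ) :=
    Finset.prod_pos fun i _ => by exact_mod_cast hpos i
  have hpc : coeff (m + 1) (pASeries a (4 + d)) = pA a (4 + d) ((m + 1 : ℕ) : ℤ) := by
    simp [pASeries]
  have hqc : coeff m (pASeries a (4 + d)) = pA a (4 + d) (((m + 1 : ℕ) : ℤ) - 1) := by
    simp [pASeries]
  have hrc : coeff (m + 2) (pASeries a (4 + d)) = pA a (4 + d) (((m + 1 : ℕ) : ℤ) + 1) := by
    simp [pASeries, add_assoc]
  have hw : coeff (m + 1) (pASeries a (4 + d) * (1 - X)) =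
      coeff (m + 1) (pASeries a (4 + d)) - coeff m (pASeries a (4 + d)) := by
    rw [mul_sub, mul_one, map_sub, coeff_succ_mul_X]
  have hv : coeff (m + 2) (pASeries a (4 + d) * (1 - X) ^ 2) = coeff (m + 2) (pASeries a (4 + d)) -
      2 * coeff (m + 1) (pASeries a (4 + d)) + coeff m (pASeries a (4 + d)) := by
    rw [show pASeries a (4 + d) * (1 - X) ^ 2 = pASeries a (4 + d) -
      C (2 : ℝ) * (pASeries a (4 + d) * X) + pASeries a (4 + d) * X ^ 2 by
        rw [map_ofNat]; ring, map_add, map_sub, coeff_C_mul, coeff_succ_mul_X, coeff_mul_X_pow]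
  have bp := coeff_pASeries_le hpos hgcd d (m + 1)
  have bq := coeff_pASeries_le hpos hgcd d m
  have bw := le_first_difference hpos hgcd d (m + 1)
  have bv := second_difference_le hpos hgcd d (m + 2)
  rw [hw] at bw
  rw [hv] at bv
  rw [hpc] at bp bw bv
  rw [hqc] at bq bw bv
  rw [hrc] at bv
  rw [← hR] at bp bq bw bv
  generalize (pA a (4 + d) ((m + 1 : ℕ) : ℤ)) = p at *
  generalize (pA a (4 + d) (((m + 1 : ℕ) : ℤ) - 1)) = q at *
  generalize (pA a (4 + d) (((m + 1 : ℕ) : ℤ) + 1)) = r at *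
  generalize errorConst a = s at *
  generalize ∏ i ∈ Finset.range (4 + d), (a i : ℝ) = Q at *
  have hf1 : (0 : ℝ) < (1 + d).factorial := by exact_mod_cast Nat.factorial_pos _
  have hf2 : ((2 + d).factorial : ℝ) = (2 + d) * (1 + d).factorial := by
    rw [show 2 + d = (1 + d) + 1 by ring, Nat.factorial_succ]; push_cast; ring
  have hf3 : ((3 + d).factorial : ℝ) = (3 + d) * ((2 + d) * (1 + d).factorial) := by
    rw [← hf2, show 3 + d = (2 + d) + 1 by ring, Nat.factorial_succ]; push_cast; ring
  rw [hf3] at bp bq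
  rw [hf2] at bw
  have hcast : ((4 + d : ℕ) : ℝ) = 4 + d := by push_cast; ring
  generalize ((1 + d).factorial : ℝ) = f at *
  set ε := 1 / (50 * ((4 + d : ℕ) : ℝ)) with hε
  have hε0 : 0 < ε := by positivity
  have hm1 : ((m + 1 : ℕ) : ℝ) = m + 1 := by push_cast; ring
  have hm2 : ((m + 2 : ℕ) : ℝ) = m + 2 := by push_cast; ring
  refine log_concave_of_bounds (k := (4 + d : ℕ)) (M := (3 + d) * ((2 + d) * f) * Q)
    (N := ((m + 1 : ℕ) : ℝ) ^ (1 + d)) hk5 (by positivity) (by positivity) hn0 (by positivity)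
    (by positivity) ?_ ?_ ?_ ?_
  · calc _ ≤ (3 + d) * ((2 + d) * f) * Q * _ := mul_le_mul_of_nonneg_left bp (by positivity)
      _ = (((m + 1 : ℕ) : ℝ) + (s + 1 + 1 + R)) ^ (3 + d) := by field_simp
      _ ≤ (((m + 1 : ℕ) : ℝ) + S) ^ (3 + d) := by gcongr; linarith
      _ ≤ _ := hpow _ (by omega)
      _ = _ := by rw [← hε]; ring
  · calc _ ≤ (3 + d) * ((2 + d) * f) * Q * _ := mul_le_mul_of_nonneg_left bq (by positivity)
      _ = ((m : ℝ) + (s + 1 + 1 + R)) ^ (3 + d) := by field_simp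
      _ ≤ (((m + 1 : ℕ) : ℝ) + S) ^ (3 + d) := by gcongr <;> linarith
      _ ≤ _ := hpow _ (by omega)
      _ = _ := by rw [← hε]; ring
  · have h1 : (((m + 1 : ℕ) : ℝ) + (1 + R)) ^ (1 + d) ≤ ((m + 1 : ℕ) : ℝ) ^ (1 + d) * 2 := by
      calc _ ≤ (((m + 1 : ℕ) : ℝ) + S) ^ (1 + d) := by gcongr; linarith
        _ ≤ _ := hpow _ (by omega)
        _ ≤ _ := by
          gcongr
          have : ε ≤ 1 := by rw [hε, div_le_one (by positivity)]; linarith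
          linarith
    have h2 : (2 + d) * s * 2 ≤ ((m + 1 : ℕ) : ℝ) * ε := by
      rw [hε, mul_one_div, le_div_iff₀ (by positivity), hcast]
      rw [hcast] at hn
      calc (2 + d) * s * 2 * (50 * (4 + d)) ≤ (4 + d) * S * 2 * (50 * (4 + d)) := by
            gcongr <;> linarith
        _ = 100 * (4 + d) ^ 2 * S := by ring
        _ ≤ _ := hn
    calc _ = (3 + d) * (((m + 1 : ℕ) : ℝ) ^ (1 + d) * ((m + 1 : ℕ) : ℝ) -
          ((m + 1 : ℕ) : ℝ) ^ (1 + d) * (((m + 1 : ℕ) : ℝ) * ε)) := by rw [← hε, hcast]; ring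
      _ ≤ (3 + d) * (((m + 1 : ℕ) : ℝ) ^ (1 + d) * ((m + 1 : ℕ) : ℝ) -
          ((m + 1 : ℕ) : ℝ) ^ (1 + d) * ((2 + d) * s * 2)) := by gcongr
      _ = (3 + d) * (((m + 1 : ℕ) : ℝ) ^ (1 + d) * ((m + 1 : ℕ) : ℝ) -
          (2 + d) * s * (((m + 1 : ℕ) : ℝ) ^ (1 + d) * 2)) := by ring
      _ ≤ (3 + d) * (((m + 1 : ℕ) : ℝ) ^ (1 + d) * ((m + 1 : ℕ) : ℝ) -
          (2 + d) * s * (((m + 1 : ℕ) : ℝ) + (1 + R)) ^ (1 + d)) := by gcongr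
      _ = (3 + d) * ((2 + d) * f) * Q * _ := by
        rw [← pow_succ, show 1 + d + 1 = 2 + d by ring]
        generalize ((m + 1 : ℕ) : ℝ) ^ (2 + d) = u
        generalize (((m + 1 : ℕ) : ℝ) + (1 + R)) ^ (1 + d) = v
        show _ = (3 + d) * ((2 + d) * f) * Q * (1 / Q * (u / ((2 + d) * f)) - s / Q * (v / f))
        field_simp
      _ ≤ _ := mul_le_mul_of_nonneg_left bw (by positivity)
  · calc _ ≤ (3 + d) * ((2 + d) * f) * Q * _ := mul_le_mul_of_nonneg_left bv (by positivity)
      _ = (3 + d) * (2 + d) * (((m + 2 : ℕ) : ℝ) + (s + R)) ^ (1 + d) := by field_simp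
      _ ≤ (3 + d) * (2 + d) * (((m + 1 : ℕ) : ℝ) + S) ^ (1 + d) := by
        gcongr (3 + (d : ℝ)) * (2 + d) * ?_ ^ (1 + d)
        rw [hm1, hm2]
        linarith
      _ ≤ (3 + d) * (2 + d) * _ := mul_le_mul_of_nonneg_left (hpow _ (by omega)) (by positivity)
      _ = _ := by rw [← hε, hcast]; ring

theorem stmt9 (a : ℕ → ℕ) (hpos : ∀ i, 0 < a i) (hmono : StrictMono a)
    (hgcd : ∀ i j, i < j → j < 4 → Nat.gcd (a i) (a j) = 1)
    (k : ℕ) (hk : 4 < k) :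
    ∀ n : ℕ,
      2 * (k : ℝ) ^ 2 * (Nat.factorial (k - 1) : ℝ) * ((a 0 : ℝ) * a 1 * a 2) ^ 3 *
          (a (k - 1) : ℝ) ^ (k + 3) * Real.exp (1 / (a (k - 1) : ℝ)) < (n : ℝ) →
      (1 + 1 / (n : ℝ) ^ 2) * (pA a k ((n : ℤ) + 1) : ℝ) * (pA a k ((n : ℤ) - 1) : ℝ) <
          (pA a k (n : ℤ) : ℝ) ^ 2 ∧
        pA a k ((n : ℤ) + 1) * pA a k ((n : ℤ) - 1) < pA a k (n : ℤ) ^ 2 := by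
  intro n hn
  obtain ⟨d, rfl⟩ : ∃ d, k = 4 + d := Nat.exists_eq_add_of_le hk.le
  have hd : 0 < d := by omega
  rw [show 4 + d - 1 = 3 + d by omega] at hn
  have h := pA_log_concave hpos hgcd hd ((hundred_mul_errorConst_le hpos hmono hd).trans hn.le)
  refine ⟨h, ?_⟩
  have h1 : (pA a (4 + d) ((n : ℤ) + 1) : ℝ) * (pA a (4 + d) ((n : ℤ) - 1) : ℝ) ≤
      (1 + 1 / (n : ℝ) ^ 2) * (pA a (4 + d) ((n : ℤ) + 1) : ℝ) *
        (pA a (4 + d) ((n : ℤ) - 1) : ℝ) := by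
    gcongr
    exact le_mul_of_one_le_left (by positivity) (le_add_of_nonneg_right (by positivity))
  exact_mod_cast h1.trans_lt h
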